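/- Let T_i : ℝⁿ → ℝⁿ be continuous for all i ∈ I and assume: (a) inv𝒫 ∩ P₂(ℝⁿ) ≠ ∅; (b) the update function Φ is almost α-firmly nonexpansive in expectation with constant α ∈ (0,1) and violation ε ∈ [0,1); (c) the Markov transport discrepancy Ψ takes the value 0 only at invariant measures and is linearly metrically subregular for 0 on P₂(ℝⁿ) with constant κ satisfying √((1−α)/(α(1+ε))) ≤ κ < √((1−α)/(αε)) (right-hand side interpreted as +∞ when ε = 0): inf_{π'∈Ψ⁻¹(0)∩P₂(ℝⁿ)} W₂(μ, π') ≤ κ·Ψ(μ) for all μ ∈ P₂(ℝⁿ). Then, with c := √(1+ε − (1−α)/(κ²α)) < 1, the distributions μ_k := μ₀𝒫ᵏ satisfy d_{W₂}(μ_{k+1}, inv𝒫) ≤ c·d_{W₂}(μ_k, inv𝒫) for all k, and (μ_k) converges R-linearly with rate c in the W₂ metric to some invariant measure π^{μ₀} ∈ inv𝒫 ∩ P₂(ℝⁿ); if inv𝒫 consists of a single measure, the convergence is Q-linear. -/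

import Mathlib

open MeasureTheory Filter Topology

noncomputable section

/-- One application of the dual Markov operator of the RFI, with `μξ` the law of `ξ`. -/
def markovStep {G I : Type*} [MeasurableSpace G] [MeasurableSpace I]
    (μξ : MeasureTheory.Measure I) (T : I → G → G) (μ : MeasureTheory.Measure G) :
    MeasureTheory.Measure G :=
  μ.bind fun x => μξ.map fun i => T i x

/-- Squared distance `‖x - y‖²` as an extended nonnegative real. -/
def q2 {H : Type*} [NormedAddCommGroup H] (x y : H) : ENNReal :=
  (‖x - y‖₊ : ENNReal) ^ 2

/-- `γ` is a coupling of `(μ, ν)`: a measure on the product with marginals `μ` and `ν`. -/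
def IsCoupling {H : Type*} [MeasurableSpace H]
    (γ : MeasureTheory.Measure (H × H)) (μ ν : MeasureTheory.Measure H) : Prop :=
  γ.map Prod.fst = μ ∧ γ.map Prod.snd = ν

/-- The squared Wasserstein-2 distance `W₂(μ,ν)²`. -/
def W2sq {H : Type*} [MeasurableSpace H] [NormedAddCommGroup H]
    (μ ν : MeasureTheory.Measure H) : ENNReal :=
  ⨅ (γ : MeasureTheory.Measure (H × H)) (_ : IsCoupling γ μ ν), ∫⁻ p, q2 p.1 p.2 ∂γ

/-- An optimal coupling of `(μ, ν)`: a coupling attaining `W₂(μ,ν)²`. -/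
def IsOptCoupling {H : Type*} [MeasurableSpace H] [NormedAddCommGroup H]
    (γ : MeasureTheory.Measure (H × H)) (μ ν : MeasureTheory.Measure H) : Prop :=
  IsCoupling γ μ ν ∧ ∫⁻ p, q2 p.1 p.2 ∂γ = W2sq μ ν

/-- Membership in `P₂(H)`: probability measures with finite second moment. -/
def MemP2 {H : Type*} [MeasurableSpace H] [NormedAddCommGroup H]
    (μ : MeasureTheory.Measure H) : Prop :=
  MeasureTheory.IsProbabilityMeasure μ ∧ ∃ x : H, ∫⁻ y, q2 x y ∂μ < ⊤

/-- The set of invariant probability measures of the RFI Markov operator. -/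
def invSet {H I : Type*} [MeasurableSpace H] [MeasurableSpace I]
    (μξ : MeasureTheory.Measure I) (T : I → H → H) : Set (MeasureTheory.Measure H) :=
  {π | MeasureTheory.IsProbabilityMeasure π ∧ markovStep μξ T π = π}

/-- The squared Markov transport discrepancy, `+∞` when `inv 𝒫` is empty or no optimal
coupling exists. -/
def PsiSq {H I : Type*} [MeasurableSpace H] [NormedAddCommGroup H] [MeasurableSpace I]
    (μξ : MeasureTheory.Measure I) (T : I → H → H) (μ : MeasureTheory.Measure H) :
    ENNReal :=
  ⨅ (π' : MeasureTheory.Measure H) (_ : π' ∈ invSet μξ T)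
    (γ : MeasureTheory.Measure (H × H)) (_ : IsOptCoupling γ μ π'),
      ∫⁻ p, (∫⁻ i, q2 (p.1 - T i p.1) (p.2 - T i p.2) ∂μξ) ∂γ

/-- The (real-valued) Wasserstein-2 distance. -/
def W2r {H : Type*} [MeasurableSpace H] [NormedAddCommGroup H]
    (μ ν : MeasureTheory.Measure H) : ℝ :=
  Real.sqrt (W2sq μ ν).toReal

/-- The (real-valued) Markov transport discrepancy `Ψ`. -/
def Psi {H I : Type*} [MeasurableSpace H] [NormedAddCommGroup H] [MeasurableSpace I]
    (μξ : MeasureTheory.Measure I) (T : I → H → H) (μ : MeasureTheory.Measure H) : ℝ :=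
  Real.sqrt (PsiSq μξ T μ).toReal

/-- The `W₂`-distance of `μ` to the set of invariant probability measures,
`d_{W₂}(μ, inv 𝒫) = inf_{π' ∈ inv 𝒫} W₂(μ, π')`. -/
def dW2inv {H I : Type*} [MeasurableSpace H] [NormedAddCommGroup H] [MeasurableSpace I]
    (μξ : MeasureTheory.Measure I) (T : I → H → H) (μ : MeasureTheory.Measure H) : ℝ :=
  Real.sqrt ((⨅ (π' : MeasureTheory.Measure H) (_ : π' ∈ invSet μξ T), W2sq μ π').toReal)

section Wasserstein

variable {E : Type*}

section Coupling

variable [MeasurableSpace E]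

lemma IsCoupling.isProbabilityMeasure {γ : Measure (E × E)} {μ ν : Measure E}
    [hμ : IsProbabilityMeasure μ] (hγ : IsCoupling γ μ ν) : IsProbabilityMeasure γ := by
  constructor
  rw [← Set.preimage_univ (f := Prod.fst), ← Measure.map_apply measurable_fst .univ, hγ.1,
    measure_univ]

lemma IsCoupling.swap {γ : Measure (E × E)} {μ ν : Measure E} (hγ : IsCoupling γ μ ν) :
    IsCoupling (γ.map Prod.swap) ν μ := by
  constructor
  · rw [Measure.map_map measurable_fst measurable_swap]; exact hγ.2
  · rw [Measure.map_map measurable_snd measurable_swap]; exact hγ.1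

lemma isCoupling_prod (μ ν : Measure E) [IsProbabilityMeasure μ] [IsProbabilityMeasure ν] :
    IsCoupling (μ.prod ν) μ ν := by
  constructor <;> simp

lemma isCoupling_diag (μ : Measure E) : IsCoupling (μ.map fun x => (x, x)) μ μ := by
  have h : Measurable fun x : E => (x, x) := by fun_prop
  constructor
  · rw [Measure.map_map measurable_fst h]; exact Measure.map_id
  · rw [Measure.map_map measurable_snd h]; exact Measure.map_id

end Coupling

variable [NormedAddCommGroup E]

lemma q2_eq_ofReal (x y : E) : q2 x y = ENNReal.ofReal (‖x - y‖ ^ 2) := by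
  rw [q2, ENNReal.ofReal_pow (norm_nonneg _), ofReal_norm, enorm_eq_nnnorm]

lemma q2_rpow (x y : E) : q2 x y = ‖x - y‖ₑ ^ (2 : ℝ) := by
  rw [q2, ENNReal.rpow_two, enorm_eq_nnnorm]

lemma q2_comm (x y : E) : q2 x y = q2 y x := by
  simp [q2_eq_ofReal, norm_sub_rev]

lemma q2_self (x : E) : q2 x x = 0 := by simp [q2]

variable [MeasurableSpace E]

lemma IsCoupling.W2sq_le {γ : Measure (E × E)} {μ ν : Measure E} (hγ : IsCoupling γ μ ν) :
    W2sq μ ν ≤ ∫⁻ p, q2 p.1 p.2 ∂γ :=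
  iInf₂_le γ hγ

/-- The Wasserstein-2 distance as an extended nonnegative real. -/
def W2e (μ ν : Measure E) : ENNReal := W2sq μ ν ^ (1 / 2 : ℝ)

lemma W2e_sq (μ ν : Measure E) : W2e μ ν ^ 2 = W2sq μ ν := by
  rw [W2e, ← ENNReal.rpow_natCast, ← ENNReal.rpow_mul]; norm_num

lemma W2e_lt_top_iff {μ ν : Measure E} : W2e μ ν < ⊤ ↔ W2sq μ ν < ⊤ := by
  rw [W2e, ENNReal.rpow_lt_top_iff_of_pos (by norm_num)]

variable [BorelSpace E] [ProperSpace E]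

lemma measurable_q2 : Measurable fun p : E × E => q2 p.1 p.2 := by
  unfold q2; fun_prop

lemma W2sq_comm_le (μ ν : Measure E) : W2sq μ ν ≤ W2sq ν μ := by
  refine le_iInf₂ fun γ hγ => hγ.swap.W2sq_le.trans_eq ?_
  rw [lintegral_map measurable_q2 measurable_swap]
  exact lintegral_congr fun p => q2_comm _ _

lemma W2sq_comm (μ ν : Measure E) : W2sq μ ν = W2sq ν μ :=
  (W2sq_comm_le μ ν).antisymm (W2sq_comm_le ν μ)

lemma lintegral_q2_diag (μ : Measure E) :
    ∫⁻ p, q2 p.1 p.2 ∂(μ.map fun x => (x, x)) = 0 := by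
  rw [lintegral_map measurable_q2 (by fun_prop)]
  simp [q2_self]

lemma W2sq_self (μ : Measure E) : W2sq μ μ = 0 :=
  le_antisymm ((isCoupling_diag μ).W2sq_le.trans_eq (lintegral_q2_diag μ)) bot_le

/-- Couplings with a fixed first marginal and weakly convergent tight second marginals
subconverge, and the quadratic transport cost is lower semicontinuous along the way. -/
lemma exists_coupling_of_tendsto {μ : Measure E} [IsProbabilityMeasure μ]
    {ν : ℕ → ProbabilityMeasure E} {ν' : ProbabilityMeasure E} (hν : Tendsto ν atTop (𝓝 ν'))
    (htight : IsTightMeasureSet (Set.range fun j => (ν j : Measure E)))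
    {γ : ℕ → Measure (E × E)} (hγ : ∀ j, IsCoupling (γ j) μ (ν j))
    {D : ℕ → ENNReal} {D' : ENNReal} (hD : Tendsto D atTop (𝓝 D'))
    (hle : ∀ j, ∫⁻ p, q2 p.1 p.2 ∂(γ j) ≤ D j) :
    ∃ γ', IsCoupling γ' μ ν' ∧ ∫⁻ p, q2 p.1 p.2 ∂γ' ≤ D' := by
  let g : ℕ → ProbabilityMeasure (E × E) := fun j => ⟨γ j, (hγ j).isProbabilityMeasure⟩
  have hT : IsTightMeasureSet {((m : ProbabilityMeasure (E × E)) : Measure (E × E)) |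
      m ∈ Set.range g} := by
    refine IsTightMeasureSet.prodMk ?_ ?_
    · refine (isTightMeasureSet_singleton (μ := μ)).subset ?_
      rintro _ ⟨_, ⟨_, ⟨j, rfl⟩, rfl⟩, rfl⟩
      exact (hγ j).1
    · refine htight.subset ?_
      rintro _ ⟨_, ⟨_, ⟨j, rfl⟩, rfl⟩, rfl⟩
      exact ⟨j, (hγ j).2.symm⟩
  obtain ⟨g', -, φ, hφ, hlim⟩ := (isCompact_closure_of_isTightMeasureSet hT).tendsto_subseq
    (x := g) fun j => subset_closure ⟨j, rfl⟩
  refine ⟨g', ⟨?_, ?_⟩, ?_⟩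
  · have h1 := ProbabilityMeasure.tendsto_map_of_tendsto_of_continuous _ _ hlim continuous_fst
    have h2 : (fun i => ((g ∘ φ) i).map continuous_fst.measurable.aemeasurable) =
        fun _ => (⟨μ, inferInstance⟩ : ProbabilityMeasure E) := by
      funext i
      exact Subtype.ext (hγ (φ i)).1
    rw [h2] at h1
    exact congrArg ProbabilityMeasure.toMeasure (tendsto_nhds_unique h1 tendsto_const_nhds)
  · have h1 := ProbabilityMeasure.tendsto_map_of_tendsto_of_continuous _ _ hlim continuous_snd
    have h2 : (fun i => ((g ∘ φ) i).map continuous_snd.measurable.aemeasurable) = ν ∘ φ := by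
      funext i
      exact Subtype.ext (hγ (φ i)).2
    rw [h2] at h1
    exact congrArg ProbabilityMeasure.toMeasure (tendsto_nhds_unique h1 (hν.comp hφ.tendsto_atTop))
  · have h1 := lintegral_le_liminf_lintegral_of_forall_isOpen_measure_le_liminf_measure
      (f := fun p : E × E => ‖p.1 - p.2‖ ^ 2) (by fun_prop) (fun p => by positivity)
      (fun G hG => ProbabilityMeasure.le_liminf_measure_open_of_tendsto hlim hG)
    simp_rw [← q2_eq_ofReal] at h1
    refine h1.trans ?_
    rw [← (hD.comp hφ.tendsto_atTop).liminf_eq]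
    exact liminf_le_liminf (Eventually.of_forall fun i => hle (φ i))

lemma exists_isOptCoupling (μ ν : Measure E) [IsProbabilityMeasure μ] [IsProbabilityMeasure ν] :
    ∃ γ, IsOptCoupling γ μ ν := by
  let S : Set ENNReal := (fun γ : Measure (E × E) => ∫⁻ p, q2 p.1 p.2 ∂γ) '' {γ | IsCoupling γ μ ν}
  have hS : sInf S = W2sq μ ν := sInf_image
  obtain ⟨D, -, hD, hmem⟩ := exists_seq_tendsto_sInf
    (S := S) ⟨_, _, isCoupling_prod μ ν, rfl⟩ (OrderBot.bddBelow S)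
  choose γ hγ hγD using hmem
  obtain ⟨γ', h1, h2⟩ := exists_coupling_of_tendsto (μ := μ)
    (ν := fun _ => (⟨ν, inferInstance⟩ : ProbabilityMeasure E)) tendsto_const_nhds
    (by simpa using! isTightMeasureSet_singleton (μ := ν)) (γ := γ) hγ hD (fun j => (hγD j).le)
  exact ⟨γ', h1, le_antisymm (h2.trans_eq hS) h1.W2sq_le⟩

lemma eq_of_W2sq_eq_zero {μ ν : Measure E} [IsProbabilityMeasure μ] [IsProbabilityMeasure ν]
    (h : W2sq μ ν = 0) : μ = ν := by
  obtain ⟨γ, hγ, hγ0⟩ := exists_isOptCoupling μ ν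
  rw [h, lintegral_eq_zero_iff measurable_q2] at hγ0
  rw [← hγ.1, ← hγ.2]
  refine Measure.map_congr ?_
  filter_upwards [hγ0] with p hp
  simpa [q2, sub_eq_zero] using hp

/-- The quadratic transport cost from a Dirac mass. -/
lemma W2sq_dirac (x : E) (μ : Measure E) [IsProbabilityMeasure μ] :
    W2sq (Measure.dirac x) μ = ∫⁻ y, q2 x y ∂μ := by
  have key : ∀ γ, IsCoupling γ (Measure.dirac x) μ →
      ∫⁻ p, q2 p.1 p.2 ∂γ = ∫⁻ y, q2 x y ∂μ := by
    intro γ hγ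
    have hx : ∀ᵐ p ∂γ, p.1 = x := by
      have h : ∀ᵐ y ∂(γ.map Prod.fst), y = x := by
        rw [hγ.1, ae_dirac_eq]
        exact rfl
      exact ae_of_ae_map measurable_fst.aemeasurable h
    rw [← hγ.2, lintegral_map (f := fun y => q2 x y)
      (measurable_q2.comp measurable_prodMk_left) measurable_snd]
    refine lintegral_congr_ae ?_
    filter_upwards [hx] with p hp
    simp [hp]
  refine le_antisymm ?_ (le_iInf₂ fun γ hγ => (key γ hγ).ge)
  exact (isCoupling_prod _ _).W2sq_le.trans_eq (key _ (isCoupling_prod _ _))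

lemma W2e_comm (μ ν : Measure E) : W2e μ ν = W2e ν μ := by rw [W2e, W2sq_comm, W2e]

lemma W2e_triangle (μ ν ρ : Measure E) [IsProbabilityMeasure μ] [IsProbabilityMeasure ν]
    [IsProbabilityMeasure ρ] : W2e μ ρ ≤ W2e μ ν + W2e ν ρ := by
  obtain ⟨γ, hγ, hγW⟩ := exists_isOptCoupling μ ν
  obtain ⟨η, hη, hηW⟩ := exists_isOptCoupling ν ρ
  have := hγ.isProbabilityMeasure
  have := hη.isProbabilityMeasure
  let τ : Measure ((E × E) × E) := γ.compProd (η.condKernel.comap Prod.snd measurable_snd)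
  have hτ1 : τ.map Prod.fst = γ := Measure.fst_compProd _ _
  have hτ2 : τ.map (fun p => (p.1.2, p.2)) = η := by
    have hm : Measurable fun p : (E × E) × E => (p.1.2, p.2) := by fun_prop
    have hη' : η.fst.compProd η.condKernel = η := η.disintegrate η.condKernel
    have hfst : η.fst = γ.map Prod.snd := hη.1.trans hγ.2.symm
    conv_rhs => rw [← hη', hfst]
    ext s hs
    rw [Measure.map_apply hm hs, Measure.compProd_apply (hm hs), Measure.compProd_apply hs,
      lintegral_map (ProbabilityTheory.Kernel.measurable_kernel_prodMk_left hs) measurable_snd]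
    rfl
  have hm12 : Measurable fun p : (E × E) × E => (p.1.1, p.2) := by fun_prop
  have hm23 : Measurable fun p : (E × E) × E => (p.1.2, p.2) := by fun_prop
  have hc : IsCoupling (τ.map fun p => (p.1.1, p.2)) μ ρ := by
    constructor
    · rw [Measure.map_map measurable_fst hm12, ← hγ.1, ← hτ1,
        Measure.map_map measurable_fst measurable_fst]
      rfl
    · rw [Measure.map_map measurable_snd hm12, ← hη.2, ← hτ2,
        Measure.map_map measurable_snd hm23]
      rfl
  have h1 : W2e μ ν = (∫⁻ p, ‖p.1.1 - p.1.2‖ₑ ^ (2 : ℝ) ∂τ) ^ (1 / 2 : ℝ) := by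
    rw [W2e, ← hγW, ← hτ1, lintegral_map measurable_q2 measurable_fst]
    simp_rw [q2_rpow]
  have h2 : W2e ν ρ = (∫⁻ p, ‖p.1.2 - p.2‖ₑ ^ (2 : ℝ) ∂τ) ^ (1 / 2 : ℝ) := by
    rw [W2e, ← hηW, ← hτ2, lintegral_map measurable_q2 hm23]
    simp_rw [q2_rpow]
  calc W2e μ ρ ≤ (∫⁻ p, ‖p.1.1 - p.2‖ₑ ^ (2 : ℝ) ∂τ) ^ (1 / 2 : ℝ) := by
        refine ENNReal.rpow_le_rpow (hc.W2sq_le.trans_eq ?_) (by norm_num)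
        rw [lintegral_map measurable_q2 hm12]
        simp_rw [q2_rpow]
    _ ≤ (∫⁻ p, ((fun p : (E × E) × E => ‖p.1.1 - p.1.2‖ₑ) +
          fun p : (E × E) × E => ‖p.1.2 - p.2‖ₑ) p ^ (2 : ℝ) ∂τ)
          ^ (1 / 2 : ℝ) := by
        refine ENNReal.rpow_le_rpow (lintegral_mono fun p => ?_) (by norm_num)
        refine ENNReal.rpow_le_rpow ?_ (by norm_num)
        rw [← sub_add_sub_cancel p.1.1 p.1.2 p.2]
        exact enorm_add_le _ _
    _ ≤ _ := by
        rw [h1, h2]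
        exact ENNReal.lintegral_Lp_add_le
          (by fun_prop : Measurable fun p : (E × E) × E => ‖p.1.1 - p.1.2‖ₑ).aemeasurable
          (by fun_prop : Measurable fun p : (E × E) × E => ‖p.1.2 - p.2‖ₑ).aemeasurable
          one_le_two

lemma memP2_iff {μ : Measure E} :
    MemP2 μ ↔ IsProbabilityMeasure μ ∧ ∃ x : E, W2e (Measure.dirac x) μ < ⊤ := by
  refine and_congr_right fun h => exists_congr fun x => ?_
  rw [W2e_lt_top_iff, W2sq_dirac]

lemma MemP2.of_W2e_lt_top {μ ν : Measure E} [IsProbabilityMeasure ν] (hμ : MemP2 μ)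
    (h : W2e μ ν < ⊤) : MemP2 ν := by
  obtain ⟨_, x, hx⟩ := memP2_iff.1 hμ
  exact memP2_iff.2 ⟨inferInstance, x,
    (W2e_triangle _ μ _).trans_lt (ENNReal.add_lt_top.2 ⟨hx, h⟩)⟩

lemma MemP2.W2e_dirac_lt_top {μ : Measure E} (hμ : MemP2 μ) (x : E) :
    W2e (Measure.dirac x) μ < ⊤ := by
  obtain ⟨_, y, hy⟩ := memP2_iff.1 hμ
  refine (W2e_triangle _ (Measure.dirac y) _).trans_lt (ENNReal.add_lt_top.2 ⟨?_, hy⟩)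
  rw [W2e_lt_top_iff, W2sq_dirac, lintegral_dirac]
  simp [q2_eq_ofReal]

lemma MemP2.W2e_lt_top {μ ν : Measure E} (hμ : MemP2 μ) (hν : MemP2 ν) : W2e μ ν < ⊤ := by
  have := hμ.1
  have := hν.1
  refine (W2e_triangle _ (Measure.dirac 0) _).trans_lt (ENNReal.add_lt_top.2
    ⟨?_, hν.W2e_dirac_lt_top 0⟩)
  rw [W2e_comm]
  exact hμ.W2e_dirac_lt_top 0

lemma isTightMeasureSet_of_W2sq_dirac_le {S : Set (Measure E)} {M : ENNReal} (hM : M ≠ ⊤)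
    (hS : ∀ μ ∈ S, IsProbabilityMeasure μ ∧ W2sq (Measure.dirac 0) μ ≤ M) :
    IsTightMeasureSet S := by
  refine isTightMeasureSet_of_tendsto_measure_compl_closedBall (x := 0) ?_
  have hlim : Tendsto (fun r : ℝ => M / ENNReal.ofReal (r ^ 2)) atTop (𝓝 0) := by
    rw [← ENNReal.div_top (a := M)]
    refine ENNReal.Tendsto.const_div ?_ (Or.inr hM)
    exact ENNReal.tendsto_ofReal_nhds_top.2 (tendsto_pow_atTop (by norm_num))
  refine tendsto_of_tendsto_of_tendsto_of_le_of_le' tendsto_const_nhds hlim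
    (Eventually.of_forall fun _ => bot_le) ?_
  filter_upwards [eventually_gt_atTop 0] with r hr
  refine iSup₂_le fun μ hμ => ?_
  obtain ⟨_, hle⟩ := hS μ hμ
  rw [W2sq_dirac] at hle
  refine (measure_mono ?_).trans ((meas_ge_le_lintegral_div
    (measurable_q2.comp measurable_prodMk_left).aemeasurable ?_ ENNReal.ofReal_ne_top).trans
    (ENNReal.div_le_div_right hle _))
  · intro y hy
    have : r < ‖y‖ := by simpa using hy
    simp only [Function.comp_apply, Set.mem_ofPred_eq, q2_eq_ofReal]
    gcongr
    simpa using this.le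
  · simpa using hr.ne'

/-- Completeness of the Wasserstein-2 distance, with control of the rate. -/
lemma exists_forall_W2e_le {ν : ℕ → Measure E} (h0 : MemP2 (ν 0))
    (hν : ∀ k, IsProbabilityMeasure (ν k)) {r : ℕ → ENNReal} (hr0 : r 0 ≠ ⊤)
    (hr : ∀ k m, k ≤ m → W2e (ν k) (ν m) ≤ r k) :
    ∃ π, IsProbabilityMeasure π ∧ ∀ k, W2e (ν k) π ≤ r k := by
  let g : ℕ → ProbabilityMeasure E := fun k => ⟨ν k, hν k⟩
  have hT : IsTightMeasureSet (Set.range ν) := by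
    refine isTightMeasureSet_of_W2sq_dirac_le (M := (W2e (Measure.dirac 0) (ν 0) + r 0) ^ 2)
      (ENNReal.pow_ne_top (ENNReal.add_ne_top.2 ⟨(h0.W2e_dirac_lt_top 0).ne, hr0⟩)) ?_
    rintro _ ⟨k, rfl⟩
    refine ⟨hν k, ?_⟩
    rw [← W2e_sq]
    gcongr
    exact (W2e_triangle _ (ν 0) _).trans (by gcongr; exact hr 0 k k.zero_le)
  obtain ⟨g', -, φ, hφ, hlim⟩ := (isCompact_closure_of_isTightMeasureSet
    (S := Set.range g) (hT.subset (by rintro _ ⟨_, ⟨k, rfl⟩, rfl⟩; exact ⟨k, rfl⟩))).tendsto_subseq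
    (x := g) fun j => subset_closure ⟨j, rfl⟩
  refine ⟨g', inferInstance, fun k => ?_⟩
  choose γ hγ hγW using fun j => exists_isOptCoupling (ν k) (ν (φ (j + k)))
  obtain ⟨γ', h1, h2⟩ := exists_coupling_of_tendsto (μ := ν k)
    (ν := fun j => g (φ (j + k))) (hlim.comp (tendsto_add_atTop_nat k))
    (hT.subset (by rintro _ ⟨j, rfl⟩; exact ⟨_, rfl⟩)) hγ
    (tendsto_const_nhds (x := r k ^ 2)) (fun j => by
      rw [hγW, ← W2e_sq]
      gcongr
      exact hr _ _ ((Nat.le_add_left k j).trans (hφ.id_le _)))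
  have h3 := h1.W2sq_le.trans h2
  rw [← W2e_sq] at h3
  exact (ENNReal.pow_le_pow_left_iff two_ne_zero).1 h3

end Wasserstein

section RandomFunctionIteration

variable {E I : Type*} [MeasurableSpace E] [MeasurableSpace I] {T : I → E → E} {μξ : Measure I}

section Measurability

variable [IsProbabilityMeasure μξ]

lemma markovStep_apply (hΦ : Measurable fun p : E × I => T p.2 p.1) (μ : Measure E)
    {s : Set E} (hs : MeasurableSet s) :
    markovStep μξ T μ s = ∫⁻ x, μξ ((fun i => T i x) ⁻¹' s) ∂μ := by
  have hm : ∀ x, Measurable fun i => T i x := fun x => hΦ.comp measurable_prodMk_left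
  have hk : Measurable fun x => μξ.map fun i => T i x := by
    refine Measure.measurable_of_measurable_coe _ fun t ht => ?_
    simp_rw [fun x => Measure.map_apply (μ := μξ) (hm x) ht]
    exact measurable_measure_prodMk_left (hΦ ht)
  rw [markovStep, Measure.bind_apply hs hk.aemeasurable]
  exact lintegral_congr fun x => Measure.map_apply (hm x) hs

lemma measurable_fst_component (hΦ : Measurable fun p : E × I => T p.2 p.1) :
    Measurable fun p : (E × E) × I => T p.2 p.1.1 :=
  hΦ.comp (by fun_prop : Measurable fun p : (E × E) × I => (p.1.1, p.2))

lemma measurable_snd_component (hΦ : Measurable fun p : E × I => T p.2 p.1) :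
    Measurable fun p : (E × E) × I => T p.2 p.1.2 :=
  hΦ.comp (by fun_prop : Measurable fun p : (E × E) × I => (p.1.2, p.2))

lemma isProbabilityMeasure_markovStep (hΦ : Measurable fun p : E × I => T p.2 p.1)
    (μ : Measure E) [IsProbabilityMeasure μ] : IsProbabilityMeasure (markovStep μξ T μ) := by
  constructor
  rw [markovStep_apply hΦ μ .univ]
  simp

/-- Driving both components of a coupling by the same noise couples the images under the
Markov operator. -/
lemma IsCoupling.map_markovStep (hΦ : Measurable fun p : E × I => T p.2 p.1)
    {γ : Measure (E × E)} {μ ν : Measure E} [IsProbabilityMeasure μ] (hγ : IsCoupling γ μ ν) :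
    IsCoupling ((γ.prod μξ).map fun p => (T p.2 p.1.1, T p.2 p.1.2))
      (markovStep μξ T μ) (markovStep μξ T ν) := by
  have := hγ.isProbabilityMeasure
  have h1 := measurable_fst_component hΦ
  have h2 := measurable_snd_component hΦ
  constructor
  · rw [Measure.map_map measurable_fst (h1.prodMk h2)]
    ext s hs
    rw [markovStep_apply hΦ μ hs, ← hγ.1,
      lintegral_map (f := fun x => μξ ((fun i => T i x) ⁻¹' s))
        (measurable_measure_prodMk_left (hΦ hs)) measurable_fst]
    change ((γ.prod μξ).map fun p => T p.2 p.1.1) s = _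
    rw [Measure.map_apply h1 hs, Measure.prod_apply (h1 hs)]
    rfl
  · rw [Measure.map_map measurable_snd (h1.prodMk h2)]
    ext s hs
    rw [markovStep_apply hΦ ν hs, ← hγ.2,
      lintegral_map (f := fun x => μξ ((fun i => T i x) ⁻¹' s))
        (measurable_measure_prodMk_left (hΦ hs)) measurable_snd]
    change ((γ.prod μξ).map fun p => T p.2 p.1.2) s = _
    rw [Measure.map_apply h2 hs, Measure.prod_apply (h2 hs)]
    rfl

end Measurability

variable [NormedAddCommGroup E] [BorelSpace E] [ProperSpace E]

/-- The squared `W₂`-distance of `μ` to the set of invariant measures. -/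
def invDistSq (μξ : Measure I) (T : I → E → E) (μ : Measure E) : ENNReal :=
  ⨅ (π : Measure E) (_ : π ∈ invSet μξ T), W2sq μ π

lemma invDistSq_lt_top {μ π : Measure E} (hπ : π ∈ invSet μξ T) (hπ2 : MemP2 π) (hμ : MemP2 μ) :
    invDistSq μξ T μ < ⊤ :=
  (iInf₂_le π hπ).trans_lt (W2e_lt_top_iff.1 (hμ.W2e_lt_top hπ2))

variable [IsProbabilityMeasure μξ]

lemma measurable_lintegral_q2_residual (hΦ : Measurable fun p : E × I => T p.2 p.1) :
    Measurable fun p : E × E => ∫⁻ i, q2 (p.1 - T i p.1) (p.2 - T i p.2) ∂μξ := by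
  have h : Measurable fun p : (E × E) × I => q2 (p.1.1 - T p.2 p.1.1) (p.1.2 - T p.2 p.1.2) :=
    measurable_q2.comp (((measurable_fst.comp measurable_fst).sub
      (measurable_fst_component hΦ)).prodMk ((measurable_snd.comp measurable_fst).sub
      (measurable_snd_component hΦ)))
  exact h.lintegral_prod_right'

/-- Integrated form of almost `α`-firm nonexpansiveness in expectation. -/
lemma IsCoupling.W2sq_markovStep_add_le (hΦ : Measurable fun p : E × I => T p.2 p.1)
    {A B : ENNReal}
    (haafne : ∀ x y : E, (∫⁻ i, q2 (T i x) (T i y) ∂μξ) +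
      A * ∫⁻ i, q2 (x - T i x) (y - T i y) ∂μξ ≤ B * q2 x y)
    {γ : Measure (E × E)} {μ ν : Measure E} [IsProbabilityMeasure μ] (hγ : IsCoupling γ μ ν) :
    W2sq (markovStep μξ T μ) (markovStep μξ T ν) +
      A * ∫⁻ p, (∫⁻ i, q2 (p.1 - T i p.1) (p.2 - T i p.2) ∂μξ) ∂γ ≤
      B * ∫⁻ p, q2 p.1 p.2 ∂γ := by
  have := hγ.isProbabilityMeasure
  have hq : Measurable fun p : (E × E) × I => q2 (T p.2 p.1.1) (T p.2 p.1.2) :=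
    measurable_q2.comp ((measurable_fst_component hΦ).prodMk (measurable_snd_component hΦ))
  have hle := (hγ.map_markovStep (μξ := μξ) hΦ).W2sq_le
  rw [lintegral_map measurable_q2 ((measurable_fst_component hΦ).prodMk
    (measurable_snd_component hΦ)), lintegral_prod _ hq.aemeasurable] at hle
  calc _ ≤ (∫⁻ p, ∫⁻ i, q2 (T i p.1) (T i p.2) ∂μξ ∂γ) +
        ∫⁻ p, A * ∫⁻ i, q2 (p.1 - T i p.1) (p.2 - T i p.2) ∂μξ ∂γ := by
        rw [lintegral_const_mul _ (measurable_lintegral_q2_residual hΦ)]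
        exact add_le_add hle le_rfl
    _ = ∫⁻ p, ((∫⁻ i, q2 (T i p.1) (T i p.2) ∂μξ) +
        A * ∫⁻ i, q2 (p.1 - T i p.1) (p.2 - T i p.2) ∂μξ) ∂γ :=
        (lintegral_add_left hq.lintegral_prod_right' _).symm
    _ ≤ ∫⁻ p, B * q2 p.1 p.2 ∂γ := lintegral_mono fun p => haafne p.1 p.2
    _ = B * ∫⁻ p, q2 p.1 p.2 ∂γ := lintegral_const_mul _ measurable_q2

lemma W2sq_markovStep_le (hΦ : Measurable fun p : E × I => T p.2 p.1) {A B : ENNReal}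
    (haafne : ∀ x y : E, (∫⁻ i, q2 (T i x) (T i y) ∂μξ) +
      A * ∫⁻ i, q2 (x - T i x) (y - T i y) ∂μξ ≤ B * q2 x y)
    (μ ν : Measure E) [IsProbabilityMeasure μ] [IsProbabilityMeasure ν] :
    W2sq (markovStep μξ T μ) (markovStep μξ T ν) ≤ B * W2sq μ ν := by
  obtain ⟨γ, hγ, hγW⟩ := exists_isOptCoupling μ ν
  rw [← hγW]
  exact le_self_add.trans (hγ.W2sq_markovStep_add_le hΦ haafne)

lemma W2e_markovStep_le (hΦ : Measurable fun p : E × I => T p.2 p.1) {A B : ENNReal}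
    (haafne : ∀ x y : E, (∫⁻ i, q2 (T i x) (T i y) ∂μξ) +
      A * ∫⁻ i, q2 (x - T i x) (y - T i y) ∂μξ ≤ B * q2 x y) (hB : B ≤ 2 ^ 2)
    (μ ν : Measure E) [IsProbabilityMeasure μ] [IsProbabilityMeasure ν] :
    W2e (markovStep μξ T μ) (markovStep μξ T ν) ≤ 2 * W2e μ ν := by
  rw [← ENNReal.pow_le_pow_left_iff two_ne_zero, mul_pow, W2e_sq, W2e_sq]
  exact (W2sq_markovStep_le hΦ haafne μ ν).trans (by gcongr)

lemma W2sq_markovStep_add_PsiSq_le (hΦ : Measurable fun p : E × I => T p.2 p.1) {A B : ENNReal}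
    (haafne : ∀ x y : E, (∫⁻ i, q2 (T i x) (T i y) ∂μξ) +
      A * ∫⁻ i, q2 (x - T i x) (y - T i y) ∂μξ ≤ B * q2 x y)
    {μ π : Measure E} [IsProbabilityMeasure μ] (hπ : π ∈ invSet μξ T) :
    W2sq (markovStep μξ T μ) π + A * PsiSq μξ T μ ≤ B * W2sq μ π := by
  have := hπ.1
  obtain ⟨γ, hγ⟩ := exists_isOptCoupling μ π
  rw [← hγ.2]
  refine le_trans ?_ (hγ.1.W2sq_markovStep_add_le hΦ haafne)
  rw [hπ.2]
  gcongr
  exact (iInf₂_le π hπ).trans (iInf₂_le γ hγ)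

lemma memP2_markovStep (hΦ : Measurable fun p : E × I => T p.2 p.1) {A B : ENNReal}
    (haafne : ∀ x y : E, (∫⁻ i, q2 (T i x) (T i y) ∂μξ) +
      A * ∫⁻ i, q2 (x - T i x) (y - T i y) ∂μξ ≤ B * q2 x y) (hB : B ≠ ⊤)
    {μ π : Measure E} (hπ : π ∈ invSet μξ T) (hπ2 : MemP2 π) (hμ : MemP2 μ) :
    MemP2 (markovStep μξ T μ) := by
  have := hμ.1
  have := hπ.1
  have := isProbabilityMeasure_markovStep (μξ := μξ) hΦ μ
  refine hπ2.of_W2e_lt_top ?_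
  rw [W2e_comm, W2e_lt_top_iff]
  have h := W2sq_markovStep_le hΦ haafne μ π
  rw [hπ.2] at h
  exact h.trans_lt (ENNReal.mul_lt_top hB.lt_top (W2e_lt_top_iff.1 (hμ.W2e_lt_top hπ2)))

lemma PsiSq_eq_zero_of_mem_invSet {π : Measure E} (hπ : π ∈ invSet μξ T)
    (hΦ : Measurable fun p : E × I => T p.2 p.1) : PsiSq μξ T π = 0 := by
  refine le_antisymm ?_ bot_le
  refine (iInf₂_le π hπ).trans ((iInf₂_le (π.map fun x => (x, x))
    ⟨isCoupling_diag π, (lintegral_q2_diag π).trans (W2sq_self π).symm⟩).trans_eq ?_)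
  rw [lintegral_map (measurable_lintegral_q2_residual hΦ) (by fun_prop)]
  simp [q2_self]

lemma invDistSq_markovStep_add_le (hΦ : Measurable fun p : E × I => T p.2 p.1) {A B : ENNReal}
    (haafne : ∀ x y : E, (∫⁻ i, q2 (T i x) (T i y) ∂μξ) +
      A * ∫⁻ i, q2 (x - T i x) (y - T i y) ∂μξ ≤ B * q2 x y) (hB : B ≠ ⊤) (hB0 : B ≠ 0)
    (μ : Measure E) [IsProbabilityMeasure μ] :
    invDistSq μξ T (markovStep μξ T μ) + A * PsiSq μξ T μ ≤ B * invDistSq μξ T μ := by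
  simp_rw [invDistSq, ENNReal.mul_iInf_of_ne hB0 hB]
  refine le_iInf₂ fun π hπ => ?_
  exact (by gcongr; exact iInf₂_le π hπ : _ ≤ _).trans (W2sq_markovStep_add_PsiSq_le hΦ haafne hπ)

/-- One step of the Markov operator contracts the distance to the invariant measures when the
Markov transport discrepancy is linearly metrically subregular. -/
lemma dW2inv_markovStep_le (hΦ : Measurable fun p : E × I => T p.2 p.1)
    {a b κ : ℝ} (ha : 0 < a) (hb : 0 < b) (hκ : 0 < κ) (hc : 0 ≤ b - a / κ ^ 2)
    (haafne : ∀ x y : E, (∫⁻ i, q2 (T i x) (T i y) ∂μξ) +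
      ENNReal.ofReal a * ∫⁻ i, q2 (x - T i x) (y - T i y) ∂μξ ≤ ENNReal.ofReal b * q2 x y)
    (hzero : ∀ μ, MemP2 μ → PsiSq μξ T μ = 0 → μ ∈ invSet μξ T)
    {μ π : Measure E} (hπ : π ∈ invSet μξ T) (hπ2 : MemP2 π) (hμ : MemP2 μ)
    (hsubreg : Real.sqrt ((⨅ (π' : Measure E)
      (_ : MemP2 π' ∧ PsiSq μξ T π' = 0), W2sq μ π').toReal) ≤ κ * Psi μξ T μ) :
    dW2inv μξ T (markovStep μξ T μ) ≤ Real.sqrt (b - a / κ ^ 2) * dW2inv μξ T μ := by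
  have := hμ.1
  have hmain := invDistSq_markovStep_add_le hΦ haafne ENNReal.ofReal_ne_top
    (by simpa using hb) μ
  have hD := invDistSq_lt_top hπ hπ2 hμ
  have hR : ENNReal.ofReal b * invDistSq μξ T μ < ⊤ := ENNReal.mul_lt_top ENNReal.ofReal_lt_top hD
  have hL := ENNReal.add_lt_top.1 (hmain.trans_lt hR)
  have hreal := ENNReal.toReal_mono hR.ne hmain
  rw [ENNReal.toReal_add hL.1.ne hL.2.ne, ENNReal.toReal_mul, ENNReal.toReal_mul,
    ENNReal.toReal_ofReal ha.le, ENNReal.toReal_ofReal hb.le] at hreal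
  have hZ : (invDistSq μξ T μ).toReal ≤ κ ^ 2 * (PsiSq μξ T μ).toReal := by
    have h1 : (invDistSq μξ T μ).toReal ≤ (⨅ (π' : Measure E)
        (_ : MemP2 π' ∧ PsiSq μξ T π' = 0), W2sq μ π').toReal := by
      refine ENNReal.toReal_mono ?_ (le_iInf₂ fun π' h => iInf₂_le π' (hzero π' h.1 h.2))
      exact ((iInf₂_le π ⟨hπ2, PsiSq_eq_zero_of_mem_invSet hπ hΦ⟩).trans_lt
        (W2e_lt_top_iff.1 (hμ.W2e_lt_top hπ2))).ne
    have h2 := pow_le_pow_left₀ (Real.sqrt_nonneg _) hsubreg 2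
    rw [Real.sq_sqrt ENNReal.toReal_nonneg, mul_pow, Psi,
      Real.sq_sqrt ENNReal.toReal_nonneg] at h2
    exact h1.trans h2
  have hZ' : a / κ ^ 2 * (invDistSq μξ T μ).toReal ≤ a * (PsiSq μξ T μ).toReal := by
    rw [div_mul_eq_mul_div, div_le_iff₀ (by positivity)]
    nlinarith
  change Real.sqrt (invDistSq μξ T (markovStep μξ T μ)).toReal ≤
    _ * Real.sqrt (invDistSq μξ T μ).toReal
  rw [← Real.sqrt_mul hc]
  refine Real.sqrt_le_sqrt ?_
  linarith

lemma W2e_markovStep_self_le (hΦ : Measurable fun p : E × I => T p.2 p.1) {A B : ENNReal}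
    (haafne : ∀ x y : E, (∫⁻ i, q2 (T i x) (T i y) ∂μξ) +
      A * ∫⁻ i, q2 (x - T i x) (y - T i y) ∂μξ ≤ B * q2 x y) (hB : B ≤ 2 ^ 2)
    {μ π : Measure E} (hπ : π ∈ invSet μξ T) (hπ2 : MemP2 π) (hμ : MemP2 μ) :
    W2e μ (markovStep μξ T μ) ≤ ENNReal.ofReal (3 * dW2inv μξ T μ) := by
  have := hμ.1
  have := isProbabilityMeasure_markovStep (μξ := μξ) hΦ μ
  have hsq : W2sq μ (markovStep μξ T μ) ≤ 9 * invDistSq μξ T μ := by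
    simp_rw [invDistSq, ENNReal.mul_iInf_of_ne (by norm_num : (9 : ENNReal) ≠ 0) (by norm_num)]
    refine le_iInf₂ fun π' hπ' => ?_
    have := hπ'.1
    have h1 : W2e μ (markovStep μξ T μ) ≤ 3 * W2e μ π' := by
      refine (W2e_triangle μ π' _).trans ?_
      have h2 := W2e_markovStep_le hΦ haafne hB π' μ
      rw [hπ'.2, W2e_comm π' μ] at h2
      calc W2e μ π' + W2e π' (markovStep μξ T μ) ≤ W2e μ π' + 2 * W2e μ π' := by gcongr
        _ = 3 * W2e μ π' := by ring
    have h3 := pow_le_pow_left' h1 2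
    rw [mul_pow, W2e_sq, W2e_sq] at h3
    norm_num at h3
    exact h3
  have hD := (invDistSq_lt_top hπ hπ2 hμ).ne
  rw [← ENNReal.pow_le_pow_left_iff two_ne_zero, W2e_sq]
  refine hsq.trans_eq ?_
  have hd : dW2inv μξ T μ ^ 2 = (invDistSq μξ T μ).toReal := Real.sq_sqrt ENNReal.toReal_nonneg
  have hd0 : 0 ≤ dW2inv μξ T μ := Real.sqrt_nonneg _
  rw [← ENNReal.ofReal_pow (by positivity), mul_pow, hd, ENNReal.ofReal_mul (by norm_num),
    ENNReal.ofReal_toReal hD]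
  norm_num

end RandomFunctionIteration

lemma W2r_eq {E : Type*} [NormedAddCommGroup E] [MeasurableSpace E] (μ ν : Measure E) :
    W2r μ ν = (W2e μ ν).toReal := by
  rw [W2r, W2e, ← ENNReal.toReal_rpow, Real.sqrt_eq_rpow]

/-- If the distance to the invariant measures decays geometrically along the iterates of the
Markov operator, then the iterates converge R-linearly to an invariant measure. -/
lemma exists_invariant_W2r_le {E I : Type*} [NormedAddCommGroup E] [MeasurableSpace E]
    [BorelSpace E] [ProperSpace E] [MeasurableSpace I] {T : I → E → E} {μξ : Measure I}
    [IsProbabilityMeasure μξ] (hΦ : Measurable fun p : E × I => T p.2 p.1) {A B : ENNReal}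
    (haafne : ∀ x y : E, (∫⁻ i, q2 (T i x) (T i y) ∂μξ) +
      A * ∫⁻ i, q2 (x - T i x) (y - T i y) ∂μξ ≤ B * q2 x y) (hB : B ≤ 2 ^ 2)
    {π₀ μ₀ : Measure E} (hπ₀ : π₀ ∈ invSet μξ T) (hπ₀2 : MemP2 π₀)
    (hμ : ∀ k, MemP2 ((markovStep μξ T)^[k] μ₀)) {c : ℝ} (hc0 : 0 ≤ c) (hc1 : c < 1)
    (hdecay : ∀ k, dW2inv μξ T ((markovStep μξ T)^[k + 1] μ₀) ≤
      c * dW2inv μξ T ((markovStep μξ T)^[k] μ₀)) :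
    ∃ π, π ∈ invSet μξ T ∧ MemP2 π ∧
      ∃ β : ℝ, 0 < β ∧ ∀ k : ℕ, W2r ((markovStep μξ T)^[k] μ₀) π ≤ β * c ^ k := by
  set ν : ℕ → Measure E := fun k => (markovStep μξ T)^[k] μ₀ with hν
  have hνs : ∀ k, ν (k + 1) = markovStep μξ T (ν k) := fun k =>
    Function.iterate_succ_apply' _ _ _
  have hνp : ∀ k, IsProbabilityMeasure (ν k) := fun k => (hμ k).1
  set d := dW2inv μξ T μ₀ with hd
  have hd0 : 0 ≤ d := Real.sqrt_nonneg _
  have hgeom : ∀ k, dW2inv μξ T (ν k) ≤ c ^ k * d := by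
    intro k
    induction k with
    | zero => simp [hν, hd]
    | succ k ih =>
      calc _ ≤ c * dW2inv μξ T (ν k) := hdecay k
        _ ≤ c * (c ^ k * d) := by gcongr
        _ = c ^ (k + 1) * d := by ring
  have h1c : 0 < 1 - c := by linarith
  set b := 3 * d / (1 - c) with hb
  have hb0 : 0 ≤ b := by positivity
  have hstep : ∀ k, W2e (ν k) (ν (k + 1)) ≤ ENNReal.ofReal (b * (c ^ k - c ^ (k + 1))) := by
    intro k
    rw [hνs]
    refine (W2e_markovStep_self_le hΦ haafne hB hπ₀ hπ₀2 (hμ k)).trans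
      (ENNReal.ofReal_le_ofReal ?_)
    have : b * (c ^ k - c ^ (k + 1)) = 3 * (c ^ k * d) := by
      rw [hb]; field_simp; ring
    rw [this]
    gcongr
    exact hgeom k
  have hpow : ∀ k m, k ≤ m → 0 ≤ b * (c ^ k - c ^ m) := fun k m h =>
    mul_nonneg hb0 (sub_nonneg.2 (pow_le_pow_of_le_one hc0 hc1.le h))
  have htel : ∀ k m, k ≤ m → W2e (ν k) (ν m) ≤ ENNReal.ofReal (b * (c ^ k - c ^ m)) := by
    intro k m hkm
    induction m, hkm using Nat.le_induction with
    | base => simp [W2e, W2sq_self]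
    | succ m hkm ih =>
      refine (W2e_triangle _ (ν m) _).trans ((add_le_add ih (hstep m)).trans_eq ?_)
      rw [← ENNReal.ofReal_add (hpow k m hkm) (hpow m _ m.le_succ)]
      rw [Nat.succ_eq_add_one]
      congr 1
      ring
  obtain ⟨π, hπp, hπ⟩ := exists_forall_W2e_le (ν := ν) (hμ 0) hνp
    (r := fun k => ENNReal.ofReal (b * c ^ k)) ENNReal.ofReal_ne_top fun k m hkm =>
      (htel k m hkm).trans (ENNReal.ofReal_le_ofReal (by
        gcongr
        exact sub_le_self _ (pow_nonneg hc0 m)))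
  have hπ2 : MemP2 π := (hμ 0).of_W2e_lt_top ((hπ 0).trans_lt ENNReal.ofReal_lt_top)
  have := isProbabilityMeasure_markovStep (μξ := μξ) hΦ π
  refine ⟨π, ⟨hπp, ?_⟩, hπ2, b + 1, by positivity, fun k => ?_⟩
  · have hle : ∀ k, W2e (markovStep μξ T π) π ≤
        2 * ENNReal.ofReal (b * c ^ k) + ENNReal.ofReal (b * c ^ (k + 1)) := by
      intro k
      refine (W2e_triangle _ (ν (k + 1)) _).trans (add_le_add ?_ (hπ (k + 1)))
      rw [hνs, W2e_comm]
      exact (W2e_markovStep_le hΦ haafne hB _ _).trans (by gcongr; exact hπ k)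
    have hlim : Tendsto (fun k : ℕ => ENNReal.ofReal (b * c ^ k)) atTop (𝓝 0) := by
      have h := (tendsto_pow_atTop_nhds_zero_of_lt_one hc0 hc1).const_mul b
      rw [mul_zero] at h
      simpa using ENNReal.tendsto_ofReal h
    have hlim2 := (ENNReal.Tendsto.const_mul (a := 2) hlim (Or.inr (by norm_num))).add
      (hlim.comp (tendsto_add_atTop_nat 1))
    rw [mul_zero, add_zero] at hlim2
    have h0 : W2e (markovStep μξ T π) π = 0 :=
      le_antisymm (ge_of_tendsto' hlim2 hle) bot_le
    refine eq_of_W2sq_eq_zero ?_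
    rw [← W2e_sq, h0]
    norm_num
  · rw [W2r_eq]
    refine (ENNReal.toReal_le_of_le_ofReal (by positivity) (hπ k)).trans ?_
    gcongr
    linarith

/-- linear convergence rates: under the assumptions of Statement 15
with a linear gauge, i.e. `Ψ` is linearly metrically subregular for `0` on `P₂(ℝⁿ)` with
constant `κ` satisfying `√((1-α)/(α(1+ε))) ≤ κ < √((1-α)/(αε))` (no upper bound when
`ε = 0`), the iterates `μ_k = μ₀𝒫ᵏ` satisfy, with `c = √(1+ε − (1-α)/(κ²α)) < 1`,
`d_{W₂}(μ_{k+1}, inv 𝒫) ≤ c·d_{W₂}(μ_k, inv 𝒫)`, and converge R-linearly with rate `c`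
to some invariant measure in `P₂(ℝⁿ)`; if `inv 𝒫` is a singleton the convergence is
Q-linear. -/
theorem stmt16
    {n : ℕ} {I : Type*} [MeasurableSpace I]
    (T : I → EuclideanSpace ℝ (Fin n) → EuclideanSpace ℝ (Fin n))
    (hT : ∀ i, Continuous (T i))
    (hΦ : Measurable fun p : EuclideanSpace ℝ (Fin n) × I => T p.2 p.1)
    (μξ : Measure I) [IsProbabilityMeasure μξ]
    (α ε : ℝ) (hα0 : 0 < α) (hα1 : α < 1) (hε0 : 0 ≤ ε) (hε1 : ε < 1)
    -- (a) existence of an invariant measure in P₂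
    (hinv : ∃ π, π ∈ invSet μξ T ∧ MemP2 π)
    -- (b) Φ is almost α-firmly nonexpansive in expectation with violation ε
    (haafne : ∀ x y : EuclideanSpace ℝ (Fin n),
      (∫⁻ i, q2 (T i x) (T i y) ∂μξ) +
        ENNReal.ofReal ((1 - α) / α) * ∫⁻ i, q2 (x - T i x) (y - T i y) ∂μξ ≤
      ENNReal.ofReal (1 + ε) * q2 x y)
    -- (c) Ψ vanishes only at invariant measures and is linearly metrically subregular
    (κ : ℝ)
    (hκlow : Real.sqrt ((1 - α) / (α * (1 + ε))) ≤ κ)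
    (hκhigh : 0 < ε → κ < Real.sqrt ((1 - α) / (α * ε)))
    (hzero : ∀ μ, MemP2 μ → PsiSq μξ T μ = 0 → μ ∈ invSet μξ T)
    (hsubreg : ∀ μ, MemP2 μ →
      Real.sqrt ((⨅ (π' : Measure (EuclideanSpace ℝ (Fin n)))
          (_ : MemP2 π' ∧ PsiSq μξ T π' = 0), W2sq μ π').toReal) ≤ κ * Psi μξ T μ)
    (μ₀ : Measure (EuclideanSpace ℝ (Fin n))) (hμ₀ : MemP2 μ₀) :
    Real.sqrt (1 + ε - (1 - α) / (κ ^ 2 * α)) < 1 ∧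
    (∀ k : ℕ, dW2inv μξ T ((markovStep μξ T)^[k + 1] μ₀) ≤
      Real.sqrt (1 + ε - (1 - α) / (κ ^ 2 * α)) *
        dW2inv μξ T ((markovStep μξ T)^[k] μ₀)) ∧
    ∃ π, π ∈ invSet μξ T ∧ MemP2 π ∧
      (∃ β : ℝ, 0 < β ∧ ∀ k : ℕ,
        W2r ((markovStep μξ T)^[k] μ₀) π ≤
          β * (Real.sqrt (1 + ε - (1 - α) / (κ ^ 2 * α))) ^ k) ∧
      ((∀ π₁ π₂ : Measure (EuclideanSpace ℝ (Fin n)),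
          π₁ ∈ invSet μξ T → π₂ ∈ invSet μξ T → π₁ = π₂) →
        ∀ k : ℕ, W2r ((markovStep μξ T)^[k + 1] μ₀) π ≤
          Real.sqrt (1 + ε - (1 - α) / (κ ^ 2 * α)) *
            W2r ((markovStep μξ T)^[k] μ₀) π) := by
  have ha : 0 < (1 - α) / α := div_pos (by linarith) hα0
  have hb : 0 < 1 + ε := by linarith
  have hκ : 0 < κ := (Real.sqrt_pos.2 (div_pos (by linarith) (by positivity))).trans_le hκlow
  have hc : 1 + ε - (1 - α) / (κ ^ 2 * α) = 1 + ε - (1 - α) / α / κ ^ 2 := by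
    rw [div_div, mul_comm α]
  rw [hc]
  have hlow : 0 ≤ 1 + ε - (1 - α) / α / κ ^ 2 := by
    have h := (Real.sqrt_le_left hκ.le).1 hκlow
    rw [← div_div, div_le_iff₀ hb] at h
    rw [sub_nonneg, div_le_iff₀ (by positivity)]
    linarith
  have hhigh : 1 + ε - (1 - α) / α / κ ^ 2 < 1 := by
    suffices ε < (1 - α) / α / κ ^ 2 by linarith
    rw [lt_div_iff₀ (by positivity)]
    rcases hε0.eq_or_lt with rfl | hε
    · simpa using ha
    · have h := (Real.lt_sqrt hκ.le).1 (hκhigh hε)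
      rw [← div_div, lt_div_iff₀ hε] at h
      linarith
  have hc1 : Real.sqrt (1 + ε - (1 - α) / α / κ ^ 2) < 1 := by
    simpa using Real.sqrt_lt_sqrt hlow hhigh
  obtain ⟨π₀, hπ₀, hπ₀2⟩ := hinv
  have hμ : ∀ k, MemP2 ((markovStep μξ T)^[k] μ₀) := by
    intro k
    induction k with
    | zero => exact hμ₀
    | succ k ih =>
      rw [Function.iterate_succ_apply']
      exact memP2_markovStep hΦ haafne ENNReal.ofReal_ne_top hπ₀ hπ₀2 ih
  have hdecay : ∀ k : ℕ, dW2inv μξ T ((markovStep μξ T)^[k + 1] μ₀) ≤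
      Real.sqrt (1 + ε - (1 - α) / α / κ ^ 2) * dW2inv μξ T ((markovStep μξ T)^[k] μ₀) := by
    intro k
    rw [Function.iterate_succ_apply']
    exact dW2inv_markovStep_le hΦ ha hb hκ hlow haafne hzero hπ₀ hπ₀2 (hμ k) (hsubreg _ (hμ k))
  have hB : ENNReal.ofReal (1 + ε) ≤ 2 ^ 2 := by
    refine ENNReal.ofReal_le_of_le_toReal ?_
    norm_num
    linarith
  obtain ⟨π, hπ, hπ2, hrate⟩ := exists_invariant_W2r_le hΦ haafne hB hπ₀ hπ₀2 hμ
    (Real.sqrt_nonneg _) hc1 hdecay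
  refine ⟨hc1, hdecay, π, hπ, hπ2, hrate, fun huniq k => ?_⟩
  have heq : ∀ μ, dW2inv μξ T μ = W2r μ π := by
    intro μ
    have h : (⨅ (π' : Measure (EuclideanSpace ℝ (Fin n))) (_ : π' ∈ invSet μξ T), W2sq μ π') =
        W2sq μ π :=
      le_antisymm (iInf₂_le π hπ) (le_iInf₂ fun π' hπ' => by rw [huniq π' π hπ' hπ])
    rw [dW2inv, h, W2r]
  simpa only [heq] using hdecay k
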